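/- For |q|<1, the identity 1 + 6·S(-q;q³) = J_{1,6}⁶ J₂³ J_{3,6}² / J₆⁹ holds, where S(a;Q) := Σ_{n≥0} (1/(1-aQ^n) - 1/(1-a^{-1}Q^{n+1})). -/

import Mathlib

open scoped BigOperators

noncomputable def poch (a q : ℂ) : ℂ := ∏' n : ℕ, (1 - a * q ^ n)

noncomputable def Jm (m : ℕ) (q : ℂ) : ℂ := poch (q ^ m) (q ^ m)

noncomputable def Jam (a m : ℕ) (q : ℂ) : ℂ :=
  poch (q ^ a) (q ^ m) * poch (q ^ (m - a)) (q ^ m) * poch (q ^ m) (q ^ m)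

noncomputable def Sser (a Q : ℂ) : ℂ :=
  ∑' n : ℕ, (1 / (1 - a * Q ^ n) - 1 / (1 - a⁻¹ * Q ^ (n + 1)))

open Filter Topology Finset

/-- The finite `q`-Pochhammer symbol `(a; q)_n`. -/
noncomputable def finPoch (a q : ℂ) (n : ℕ) : ℂ := ∏ j ∈ range n, (1 - a * q ^ j)

lemma one_sub_ne_zero_of_norm_lt {z : ℂ} (h : ‖z‖ < 1) : 1 - z ≠ 0 := by
  intro h0
  rw [← sub_eq_zero.mp h0, norm_one] at h
  exact lt_irrefl _ h

lemma norm_mul_pow_lt_one {a q : ℂ} (ha : ‖a‖ < 1) (hq : ‖q‖ < 1) (n : ℕ) :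
    ‖a * q ^ n‖ < 1 := by
  rw [norm_mul, norm_pow]
  exact (mul_le_of_le_one_right (norm_nonneg _) (pow_le_one₀ (norm_nonneg _) hq.le)).trans_lt ha

lemma summable_norm_mul_geometric (a : ℂ) {q : ℂ} (hq : ‖q‖ < 1) :
    Summable fun n : ℕ => ‖-(a * q ^ n)‖ := by
  simp only [norm_neg, norm_mul, norm_pow]
  exact (summable_geometric_of_lt_one (norm_nonneg _) hq).mul_left _

lemma tendsto_finPoch (a : ℂ) {q : ℂ} (hq : ‖q‖ < 1) :
    Tendsto (finPoch a q) atTop (𝓝 (poch a q)) := by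
  have h := (multipliable_one_add_of_summable (summable_norm_mul_geometric a hq)).hasProd
  simp only [← sub_eq_add_neg] at h
  exact h.tendsto_prod_nat

lemma poch_ne_zero {a q : ℂ} (hq : ‖q‖ < 1) (h : ∀ n : ℕ, 1 - a * q ^ n ≠ 0) :
    poch a q ≠ 0 := by
  have := tprod_one_add_ne_zero_of_summable (f := fun n : ℕ => -(a * q ^ n))
    (fun n => by simpa only [← sub_eq_add_neg] using h n) (summable_norm_mul_geometric a hq)
  simpa only [poch, ← sub_eq_add_neg] using this

lemma poch_ne_zero_of_norm_lt {a q : ℂ} (ha : ‖a‖ < 1) (hq : ‖q‖ < 1) : poch a q ≠ 0 :=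
  poch_ne_zero hq fun n => one_sub_ne_zero_of_norm_lt (norm_mul_pow_lt_one ha hq n)

lemma finPoch_ne_zero_of_norm_lt {a q : ℂ} (ha : ‖a‖ < 1) (hq : ‖q‖ < 1) (n : ℕ) :
    finPoch a q n ≠ 0 :=
  prod_ne_zero_iff.mpr fun j _ => one_sub_ne_zero_of_norm_lt (norm_mul_pow_lt_one ha hq j)

lemma poch_eq_one_sub_mul (a : ℂ) {q : ℂ} (hq : ‖q‖ < 1) :
    poch a q = (1 - a) * poch (a * q) q := by
  refine tendsto_nhds_unique ((tendsto_finPoch a hq).comp (tendsto_add_atTop_nat 1))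
    (((tendsto_finPoch (a * q) hq).const_mul (1 - a)).congr fun n => ?_)
  simp only [finPoch, Function.comp, prod_range_succ', pow_succ, pow_zero, mul_one]
  rw [mul_comm]
  congr 1
  exact prod_congr rfl fun j _ => by ring

lemma norm_pow_lt_one {q : ℂ} (hq : ‖q‖ < 1) {k : ℕ} (hk : k ≠ 0) : ‖q ^ k‖ < 1 := by
  rw [norm_pow]
  exact pow_lt_one₀ (norm_nonneg _) hq hk

lemma poch_dissect_two (a : ℂ) {q : ℂ} (hq : ‖q‖ < 1) :
    poch a q = poch a (q ^ 2) * poch (a * q) (q ^ 2) := by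
  have h2 := norm_pow_lt_one hq two_ne_zero
  refine tendsto_nhds_unique ((tendsto_finPoch a hq).comp
    (tendsto_id.const_mul_atTop' (two_pos : 0 < 2)))
    (((tendsto_finPoch a h2).mul (tendsto_finPoch (a * q) h2)).congr fun n => ?_)
  simp only [finPoch, Function.comp, id]
  induction n with
  | zero => simp
  | succ n ih =>
    rw [show 2 * (n + 1) = 2 * n + 1 + 1 by ring]
    simp only [prod_range_succ, ← ih]
    ring

lemma poch_dissect_three (a : ℂ) {q : ℂ} (hq : ‖q‖ < 1) :
    poch a q = poch a (q ^ 3) * poch (a * q) (q ^ 3) * poch (a * q ^ 2) (q ^ 3) := by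
  have h3 := norm_pow_lt_one hq three_ne_zero
  refine tendsto_nhds_unique ((tendsto_finPoch a hq).comp
    (tendsto_id.const_mul_atTop' (three_pos : 0 < 3)))
    ((((tendsto_finPoch a h3).mul (tendsto_finPoch (a * q) h3)).mul
      (tendsto_finPoch (a * q ^ 2) h3)).congr fun n => ?_)
  simp only [finPoch, Function.comp, id]
  induction n with
  | zero => simp
  | succ n ih =>
    rw [show 3 * (n + 1) = 3 * n + 1 + 1 + 1 by ring]
    simp only [prod_range_succ, ← ih]
    ring

lemma poch_mul_poch_neg (a : ℂ) {q : ℂ} (hq : ‖q‖ < 1) :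
    poch a q * poch (-a) q = poch (a ^ 2) (q ^ 2) := by
  refine tendsto_nhds_unique ((tendsto_finPoch a hq).mul (tendsto_finPoch (-a) hq))
    ((tendsto_finPoch (a ^ 2) (norm_pow_lt_one hq two_ne_zero)).congr fun n => ?_)
  simp only [finPoch, ← prod_mul_distrib]
  exact prod_congr rfl fun j _ => by ring

lemma poch_cube {x : ℂ} (hx : x ^ 2 + x + 1 = 0) (a : ℂ) {q : ℂ} (hq : ‖q‖ < 1) :
    poch a q * poch (x * a) q * poch (x ^ 2 * a) q = poch (a ^ 3) (q ^ 3) := by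
  refine tendsto_nhds_unique (((tendsto_finPoch a hq).mul (tendsto_finPoch (x * a) hq)).mul
    (tendsto_finPoch (x ^ 2 * a) hq))
    ((tendsto_finPoch (a ^ 3) (norm_pow_lt_one hq three_ne_zero)).congr fun n => ?_)
  simp only [finPoch, ← prod_mul_distrib]
  refine prod_congr rfl fun j _ => ?_
  linear_combination (a * q ^ j - (a * q ^ j) ^ 2 * x + (a * q ^ j) ^ 3 * (x - 1)) * hx

/-- Partial fraction expansion of `∏ k < M, (v - x a_k) / (v - a_k)`. -/
lemma prod_div_eq_one_add_sum {a : ℕ → ℂ} {M : ℕ} (ha : Set.InjOn a (range M)) (x v : ℂ)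
    (hv : ∀ k < M, v ≠ a k) :
    ∏ k ∈ range M, (v - x * a k) / (v - a k) =
      1 + ∑ i ∈ range M, (∏ j ∈ (range M).erase i, (a i - a j)⁻¹) *
        (∏ k ∈ range M, (a i - x * a k)) * (v - a i)⁻¹ := by
  classical
  set p := Lagrange.nodal (range M) (fun k => x * a k) with hp
  set r := Lagrange.nodal (range M) a with hr
  have hdeg : (p - r).degree < (#(range M) : ℕ) := by
    have := Polynomial.degree_sub_lt_left (p := p) (q := r)
      (by rw [Lagrange.degree_nodal, Lagrange.degree_nodal])
      (Lagrange.nodal_monic.ne_zero)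
      (by rw [Lagrange.nodal_monic.leadingCoeff, Lagrange.nodal_monic.leadingCoeff])
    rwa [hp, Lagrange.degree_nodal] at this
  have key := Lagrange.eq_interpolate_of_eval_eq (r := fun i => ∏ k ∈ range M, (a i - x * a k))
    (f := p - r) ha hdeg (fun i hi => by
      rw [Polynomial.eval_sub, hr, Lagrange.eval_nodal_at_node hi, hp, Lagrange.eval_nodal,
        sub_zero])
  have e := congrArg (Polynomial.eval v) key
  rw [Lagrange.eval_interpolate_not_at_node _ (fun i hi => hv i (mem_range.mp hi)),
    Polynomial.eval_sub, hp, hr, Lagrange.eval_nodal, Lagrange.eval_nodal, sub_eq_iff_eq_add] at e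
  have hne : ∏ k ∈ range M, (v - a k) ≠ 0 :=
    prod_ne_zero_iff.mpr fun k hk => sub_ne_zero.mpr (hv k (mem_range.mp hk))
  rw [prod_div_distrib, e, add_div, div_self hne, mul_div_cancel_left₀ _ hne, add_comm]
  congr 1
  refine sum_congr rfl fun i _ => ?_
  rw [Lagrange.nodalWeight]
  ring

lemma prod_range_below {x : ℂ} (hx : x ^ 3 = 1) (q t : ℂ) (s : ℕ) :
    ∏ k ∈ range s, (t * q ^ s - x * q ^ k) = (∏ k ∈ range s, -q ^ k) *
      (x ^ s * finPoch (x ^ 2 * t * q) q s) := by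
  rw [finPoch, ← prod_range_reflect (fun j => 1 - x ^ 2 * t * q * q ^ j), 
    show x ^ s = ∏ _k ∈ range s, x by simp, ← prod_mul_distrib, ← prod_mul_distrib]
  refine prod_congr rfl fun k hk => ?_
  obtain ⟨d, rfl⟩ := Nat.exists_eq_add_of_lt (mem_range.mp hk)
  rw [show k + d + 1 - 1 - k = d by omega]
  linear_combination (-t * q ^ (k + d + 1)) * hx

lemma prod_range_above {t : ℂ} (ht : t ^ 2 = 1) (x q : ℂ) (s e m : ℕ) :
    ∏ j ∈ range m, (t * q ^ s - x * q ^ (s + e + j)) = (∏ _j ∈ range m, t * q ^ s) *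
      finPoch (t * x * q ^ e) q m := by
  rw [finPoch, ← prod_mul_distrib]
  refine prod_congr rfl fun k _ => ?_
  linear_combination (x * q ^ (s + e + k)) * ht

lemma pow_injective_of_norm_lt_one {q : ℂ} (hq0 : q ≠ 0) (hq : ‖q‖ < 1) :
    Function.Injective (fun n : ℕ => q ^ n) := fun i j h => by
  have h' := congrArg norm (show q ^ i = q ^ j from h)
  rw [norm_pow, norm_pow] at h'
  exact pow_right_injective₀ (norm_pos_iff.mpr hq0) hq.ne h'

lemma one_add_pow_ne_zero {q : ℂ} (hq : ‖q‖ < 1) (k : ℕ) : 1 + q ^ k ≠ 0 := by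
  rcases Nat.eq_zero_or_pos k with rfl | hk
  · norm_num
  · simpa using one_sub_ne_zero_of_norm_lt (z := -q ^ k)
      (by rw [norm_neg]; exact norm_pow_lt_one hq hk.ne')

lemma finPoch_neg_one_ne_zero {q : ℂ} (hq : ‖q‖ < 1) (n : ℕ) : finPoch (-1) q n ≠ 0 :=
  prod_ne_zero_iff.mpr fun j _ => by simpa using one_add_pow_ne_zero hq j

/-- The ratio `(xq; q)_n / (q; q)_n`. -/
noncomputable def pochRatio (x q : ℂ) (n : ℕ) : ℂ := finPoch (x * q) q n / finPoch q q n

lemma partialFraction_weight {x : ℂ} (hx : x ^ 3 = 1) {q : ℂ} (hq0 : q ≠ 0) (hq : ‖q‖ < 1)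
    (i m : ℕ) :
    (∏ j ∈ (range (i + 1 + m)).erase i, (q ^ i - q ^ j)⁻¹) *
      (∏ k ∈ range (i + 1 + m), (q ^ i - x * q ^ k)) =
    q ^ i * (1 - x) * x ^ i * pochRatio (x ^ 2) q i * pochRatio x q m := by
  have hE : ∏ j ∈ (range (i + 1 + m)).erase i, (q ^ i - q ^ j)⁻¹ =
      (∏ k ∈ range i, (q ^ i - q ^ k)⁻¹) * ∏ j ∈ range m, (q ^ i - q ^ (i + 1 + j))⁻¹ := by
    have h0 := mul_prod_erase (range (i + 1 + m))
      (fun j => if j = i then (1 : ℂ) else (q ^ i - q ^ j)⁻¹) (mem_range.mpr (by omega : i < _))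
    rw [if_pos rfl, one_mul, prod_range_add, prod_range_succ, if_pos rfl, mul_one] at h0
    rw [prod_congr rfl fun j hj => (if_neg (ne_of_mem_erase hj)).symm, h0]
    congr 1
    · exact prod_congr rfl fun j hj => if_neg (mem_range.mp hj).ne
    · exact prod_congr rfl fun j _ => if_neg (by omega)
  have b1 := prod_range_below hx q 1 i
  have b2 := prod_range_below (one_pow 3) q 1 i
  have a1 := prod_range_above (one_pow 2) x q i 1 m
  have a2 := prod_range_above (one_pow 2) 1 q i 1 m
  simp only [one_mul, one_pow, mul_one, pow_one] at b1 b2 a1 a2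
  rw [hE, prod_range_add, prod_range_succ, prod_inv_distrib, prod_inv_distrib, b1, b2, a1, a2,
    pochRatio, pochRatio]
  have h1 : ∏ k ∈ range i, -q ^ k ≠ 0 :=
    prod_ne_zero_iff.mpr fun k _ => neg_ne_zero.mpr (pow_ne_zero _ hq0)
  have h2 : ∏ _j ∈ range m, q ^ i ≠ 0 := prod_ne_zero_iff.mpr fun k _ => pow_ne_zero _ hq0
  have h3 := finPoch_ne_zero_of_norm_lt hq hq i
  have h4 := finPoch_ne_zero_of_norm_lt hq hq m
  field_simp

lemma prod_ratio_eq {x : ℂ} (hx : x ^ 3 = 1) {q : ℂ} (hq0 : q ≠ 0) (hq : ‖q‖ < 1) (s m : ℕ) :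
    ∏ k ∈ range (s + m), (-q ^ s - x * q ^ k) / (-q ^ s - q ^ k) =
      x ^ s * (finPoch (-(x ^ 2 * q)) q s / finPoch (-q) q s) *
        (finPoch (-x) q m / finPoch (-1) q m) := by
  have b1 := prod_range_below hx q (-1) s
  have b2 := prod_range_below (one_pow 3) q (-1) s
  have a1 := prod_range_above (t := -1) (by norm_num) x q s 0 m
  have a2 := prod_range_above (t := -1) (by norm_num) 1 q s 0 m
  simp only [one_mul, one_pow, mul_one, pow_zero, add_zero, mul_neg, neg_mul] at b1 b2 a1 a2
  rw [prod_div_distrib, prod_range_add, prod_range_add, b1, b2, a1, a2]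
  have h1 : ∏ k ∈ range s, -q ^ k ≠ 0 :=
    prod_ne_zero_iff.mpr fun k _ => neg_ne_zero.mpr (pow_ne_zero _ hq0)
  have h2 : ∏ _j ∈ range m, -q ^ s ≠ 0 :=
    prod_ne_zero_iff.mpr fun k _ => neg_ne_zero.mpr (pow_ne_zero _ hq0)
  have h3 := finPoch_ne_zero_of_norm_lt (a := -q) (by simpa using hq) hq s
  have h4 := finPoch_neg_one_ne_zero hq m
  field_simp

/-- The differences of the sequence `1 / (1 + q ^ k)`. -/
noncomputable def invDiff (q : ℂ) (k : ℕ) : ℂ := 1 / (1 + q ^ k) - 1 / (1 + q ^ (k + 1))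

lemma prod_ratio_sub {x : ℂ} (hx : x ^ 3 = 1) {q : ℂ} (hq0 : q ≠ 0) (hq : ‖q‖ < 1) {n : ℕ}
    (hn : x ^ (n + 1) = 1) :
    finPoch (-(x ^ 2 * q)) q (n + 1) / finPoch (-q) q (n + 1) *
        (finPoch (-x) q (n + 1) / finPoch (-1) q (n + 1)) -
      x ^ 2 * (finPoch (-(x ^ 2 * q)) q n / finPoch (-q) q n) *
        (finPoch (-x) q (n + 2) / finPoch (-1) q (n + 2)) =
    (1 - x) * ∑ k ∈ range (n + 1), invDiff q k *
      (x ^ k * (pochRatio (x ^ 2) q (n + 1 + k) * pochRatio x q (n - k)) +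
        x ^ (2 * k + 2) * (pochRatio (x ^ 2) q (n - k) * pochRatio x q (n + 1 + k))) := by
  have hx0 : x ≠ 0 := by rintro rfl; norm_num at hx
  have hxn : x ^ n = x ^ 2 := by
    refine mul_right_cancel₀ hx0 ?_
    rw [← pow_succ, hn, ← pow_succ, hx]
  have hinj := pow_injective_of_norm_lt_one hq0 hq
  have hne : ∀ s k : ℕ, -q ^ s ≠ q ^ k := by
    intro s k h
    have h' := congrArg norm h
    rw [norm_neg, norm_pow, norm_pow] at h'
    obtain rfl := pow_right_injective₀ (norm_pos_iff.mpr hq0) hq.ne h'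
    exact pow_ne_zero s hq0 (self_eq_neg.mp h.symm)
  have e1 := prod_div_eq_one_add_sum (M := n + 1 + (n + 1)) hinj.injOn x (-q ^ (n + 1))
    fun k _ => hne _ k
  have e2 := prod_div_eq_one_add_sum (M := n + (n + 2)) hinj.injOn x (-q ^ n)
    fun k _ => hne _ k
  rw [prod_ratio_eq hx hq0 hq, hn, one_mul] at e1
  rw [prod_ratio_eq hx hq0 hq, hxn, show n + (n + 2) = n + 1 + (n + 1) by ring] at e2
  rw [e1, e2, add_sub_add_left_eq_sub, ← sum_sub_distrib, sum_range_add, ← sum_range_reflect,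
    ← sum_add_distrib, mul_sum]
  refine sum_congr rfl fun k hk => ?_
  obtain ⟨d, rfl⟩ := Nat.exists_eq_add_of_le (Nat.lt_succ_iff.mp (mem_range.mp hk))
  have w1 := partialFraction_weight hx hq0 hq d (k + d + 1 + k)
  have w2 := partialFraction_weight hx hq0 hq (k + d + 1 + k) d
  rw [show d + 1 + (k + d + 1 + k) = k + d + 1 + (k + d + 1) by ring] at w1
  rw [show k + d + 1 + k + 1 + d = k + d + 1 + (k + d + 1) by ring] at w2
  rw [show k + d + 1 - 1 - k = d by omega, show k + d - k = d by omega, w1, w2]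
  have hxd : x ^ d = x ^ (2 * k + 2) := by
    refine mul_right_cancel₀ (pow_ne_zero (k + 1) hx0) ?_
    rw [← pow_add, ← pow_add, show d + (k + 1) = k + d + 1 by ring, hn,
      show 2 * k + 2 + (k + 1) = 3 * (k + 1) by ring, pow_mul, hx, one_pow]
  have hxk : x ^ (k + d + 1 + k) = x ^ k := by rw [pow_add, hn, one_mul]
  have g1 : q ^ d * ((-q ^ (k + d + 1) - q ^ d)⁻¹ - (-q ^ (k + d) - q ^ d)⁻¹) = invDiff q k := by
    have h1 := one_add_pow_ne_zero hq k
    have h2 := one_add_pow_ne_zero hq (k + 1)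
    have h3 := pow_ne_zero d hq0
    rw [show -q ^ (k + d + 1) - q ^ d = -(q ^ d * (1 + q ^ (k + 1))) by ring,
      show -q ^ (k + d) - q ^ d = -(q ^ d * (1 + q ^ k)) by ring, invDiff]
    field_simp
    ring
  have g2 : q ^ (k + d + 1 + k) * ((-q ^ (k + d + 1) - q ^ (k + d + 1 + k))⁻¹ -
      (-q ^ (k + d) - q ^ (k + d + 1 + k))⁻¹) = invDiff q k := by
    have h1 := one_add_pow_ne_zero hq k
    have h2 := one_add_pow_ne_zero hq (k + 1)
    have h3 := pow_ne_zero (k + d) hq0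
    rw [show -q ^ (k + d + 1) - q ^ (k + d + 1 + k) = -(q ^ (k + d) * (q * (1 + q ^ k))) by ring,
      show -q ^ (k + d) - q ^ (k + d + 1 + k) = -(q ^ (k + d) * (1 + q ^ (k + 1))) by ring,
      show q ^ (k + d + 1 + k) = q ^ (k + d) * (q * q ^ k) by ring, invDiff]
    field_simp
    ring
  rw [hxd, hxk]
  linear_combination
    ((1 - x) * x ^ (2 * k + 2) * pochRatio (x ^ 2) q d * pochRatio x q (k + d + 1 + k)) * g1 +
    ((1 - x) * x ^ k * pochRatio (x ^ 2) q (k + d + 1 + k) * pochRatio x q d) * g2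

lemma norm_invDiff_le {q : ℂ} (hq : ‖q‖ < 1) (k : ℕ) :
    ‖invDiff q k‖ ≤ 2 / (1 - ‖q‖) ^ 2 * ‖q‖ ^ k := by
  have hpos : 0 < 1 - ‖q‖ := sub_pos.mpr hq
  have hlow : ∀ j : ℕ, 1 - ‖q‖ ≤ ‖1 + q ^ j‖ := by
    intro j
    rcases Nat.eq_zero_or_pos j with rfl | hj
    · norm_num
      linarith [norm_nonneg q]
    · have h1 := norm_sub_norm_le (1 : ℂ) (-q ^ j)
      rw [sub_neg_eq_add, norm_one, norm_neg, norm_pow] at h1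
      have h2 := pow_le_of_le_one (norm_nonneg q) hq.le hj.ne'
      linarith
  have e : invDiff q k = q ^ k * (q - 1) / ((1 + q ^ k) * (1 + q ^ (k + 1))) := by
    have h1 := one_add_pow_ne_zero hq k
    have h2 := one_add_pow_ne_zero hq (k + 1)
    rw [invDiff]
    field_simp
    ring
  have h3 : ‖q - 1‖ ≤ 2 := (norm_sub_le _ _).trans (by rw [norm_one]; linarith)
  rw [e, norm_div, norm_mul, norm_mul, norm_pow, div_mul_eq_mul_div, mul_comm (2 : ℝ), sq]
  gcongr
  · exact hlow k
  · exact hlow (k + 1)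

lemma tendsto_pochRatio (x : ℂ) {q : ℂ} (hq : ‖q‖ < 1) :
    Tendsto (pochRatio x q) atTop (𝓝 (poch (x * q) q / poch q q)) :=
  (tendsto_finPoch _ hq).div (tendsto_finPoch _ hq) (poch_ne_zero_of_norm_lt hq hq)

lemma exists_norm_pochRatio_le (x : ℂ) {q : ℂ} (hq : ‖q‖ < 1) :
    ∃ C, ∀ n, ‖pochRatio x q n‖ ≤ C := by
  obtain ⟨C, hC⟩ := isBounded_iff_forall_norm_le.mp
    (Metric.isBounded_range_of_tendsto _ (tendsto_pochRatio x hq))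
  exact ⟨C, fun n => hC _ (Set.mem_range_self n)⟩

lemma summable_geometric_bound (C : ℝ) {q : ℂ} (hq : ‖q‖ < 1) :
    Summable fun k : ℕ => C * ‖q‖ ^ k :=
  (summable_geometric_of_lt_one (norm_nonneg _) hq).mul_left _

lemma summable_invDiff_mul {x : ℂ} (hx1 : ‖x‖ = 1) {q : ℂ} (hq : ‖q‖ < 1) :
    Summable fun k => invDiff q k * (x ^ k + x ^ (2 * k + 2)) := by
  refine .of_norm_bounded (summable_geometric_bound (2 / (1 - ‖q‖) ^ 2 * 2) hq) fun k => ?_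
  rw [norm_mul, mul_right_comm]
  refine mul_le_mul (norm_invDiff_le hq k) ((norm_add_le _ _).trans ?_) (norm_nonneg _)
    (by positivity)
  rw [norm_pow, norm_pow, hx1]
  norm_num

lemma tendsto_sum_pochRatio {x : ℂ} (hx1 : ‖x‖ = 1) {q : ℂ} (hq : ‖q‖ < 1) :
    Tendsto (fun n => ∑ k ∈ range (n + 1), invDiff q k *
      (x ^ k * (pochRatio (x ^ 2) q (n + 1 + k) * pochRatio x q (n - k)) +
        x ^ (2 * k + 2) * (pochRatio (x ^ 2) q (n - k) * pochRatio x q (n + 1 + k)))) atTop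
      (𝓝 (∑' k, invDiff q k * (x ^ k * (poch (x ^ 2 * q) q / poch q q * (poch (x * q) q / poch q q))
        + x ^ (2 * k + 2) * (poch (x ^ 2 * q) q / poch q q * (poch (x * q) q / poch q q))))) := by
  obtain ⟨C, hC⟩ := exists_norm_pochRatio_le x hq
  obtain ⟨D, hD⟩ := exists_norm_pochRatio_le (x ^ 2) hq
  have hC0 : 0 ≤ C := (norm_nonneg _).trans (hC 0)
  have hD0 : 0 ≤ D := (norm_nonneg _).trans (hD 0)
  have hsub : ∀ k : ℕ, Tendsto (fun n : ℕ => n - k) atTop atTop := tendsto_sub_atTop_nat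
  have hadd : ∀ k : ℕ, Tendsto (fun n : ℕ => n + 1 + k) atTop atTop := fun k =>
    (tendsto_add_atTop_nat k).comp (tendsto_add_atTop_nat 1)
  have hA := tendsto_pochRatio x hq
  have hB := tendsto_pochRatio (x ^ 2) hq
  have main := tendsto_tsum_of_dominated_convergence (𝓕 := atTop)
    (f := fun n k => if k ∈ range (n + 1) then invDiff q k *
      (x ^ k * (pochRatio (x ^ 2) q (n + 1 + k) * pochRatio x q (n - k)) +
        x ^ (2 * k + 2) * (pochRatio (x ^ 2) q (n - k) * pochRatio x q (n + 1 + k))) else 0)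
    (g := fun k => invDiff q k *
      (x ^ k * (poch (x ^ 2 * q) q / poch q q * (poch (x * q) q / poch q q))
        + x ^ (2 * k + 2) * (poch (x ^ 2 * q) q / poch q q * (poch (x * q) q / poch q q))))
    (summable_geometric_bound (2 / (1 - ‖q‖) ^ 2 * (D * C + D * C)) hq) ?_ ?_
  · refine main.congr fun n => ?_
    rw [tsum_eq_sum (s := range (n + 1)) fun k hk => if_neg hk]
    exact sum_congr rfl fun k hk => if_pos hk
  · intro k
    refine Tendsto.congr' (f₁ := fun n => invDiff q k *
      (x ^ k * (pochRatio (x ^ 2) q (n + 1 + k) * pochRatio x q (n - k)) +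
        x ^ (2 * k + 2) * (pochRatio (x ^ 2) q (n - k) * pochRatio x q (n + 1 + k)))) ?_ ?_
    · filter_upwards [eventually_ge_atTop k] with n hn
      rw [if_pos (mem_range.mpr (by omega))]
    · exact ((((hB.comp (hadd k)).mul (hA.comp (hsub k))).const_mul _).add
        (((hB.comp (hsub k)).mul (hA.comp (hadd k))).const_mul _)).const_mul _
  · refine Eventually.of_forall fun n k => ?_
    split_ifs with hk
    · rw [norm_mul, mul_right_comm]
      refine mul_le_mul (norm_invDiff_le hq k) ((norm_add_le _ _).trans ?_) (norm_nonneg _)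
        (by positivity)
      simp only [norm_mul, norm_pow x, hx1, one_pow, one_mul]
      exact add_le_add (mul_le_mul (hD _) (hC _) (norm_nonneg _) hD0)
        (mul_le_mul (hD _) (hC _) (norm_nonneg _) hD0)
    · rw [norm_zero]
      positivity

lemma tsum_invDiff_mul {x : ℂ} (hx : x ^ 2 + x + 1 = 0) (hx1 : ‖x‖ = 1) {q : ℂ}
    (hq : ‖q‖ < 1) :
    ∑' k, invDiff q k * (x ^ k + x ^ (2 * k + 2)) =
      x / 2 * (1 + 6 * Sser (-q) (q ^ 3)) := by
  have hx3 : x ^ 3 = 1 := by linear_combination (x - 1) * hx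
  have hS : Sser (-q) (q ^ 3) = ∑' m, invDiff q (3 * m + 1) := by
    refine tsum_congr fun m => ?_
    by_cases hq0 : q = 0
    · subst hq0
      simp [invDiff]
    · rw [invDiff]
      congr 2
      · ring
      · field_simp
        ring
  have hsum : Summable fun m => invDiff q (3 * m + 1) := by
    have h := (Summable.of_norm_bounded (summable_geometric_bound _ hq) (norm_invDiff_le hq))
    exact h.comp_injective (i := fun m => 3 * m + 1) fun a b h => by simpa using h
  have hpow : Tendsto (fun n : ℕ => 1 / (1 + q ^ (3 * n))) atTop (𝓝 (1 / (1 + 0))) := by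
    refine tendsto_const_nhds.div (tendsto_const_nhds.add ?_) (by norm_num)
    exact (tendsto_pow_atTop_nhds_zero_of_norm_lt_one hq).comp
      (tendsto_id.const_mul_atTop' (three_pos : 0 < 3))
  have hlim := ((hpow.const_sub (1 / 2)).const_mul (-x)).add
    (hsum.hasSum.tendsto_sum_nat.const_mul (3 * x))
  have hlim' := (summable_invDiff_mul hx1 hq).hasSum.tendsto_sum_nat.comp
    (tendsto_id.const_mul_atTop' (three_pos : 0 < 3))
  rw [tendsto_nhds_unique hlim' (hlim.congr fun n => ?_), hS]
  · ring
  · simp only [Function.comp, id]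
    induction n with
    | zero => norm_num
    | succ n ih =>
      rw [show 3 * (n + 1) = 3 * n + 1 + 1 + 1 by ring]
      simp only [sum_range_succ, ← ih]
      generalize ∑ i ∈ range n, invDiff q (3 * i + 1) = T
      have p0 : x ^ (3 * n) = 1 := by rw [pow_mul, hx3, one_pow]
      have p1 : x ^ (3 * n + 1) = x := by rw [pow_succ, p0, one_mul]
      have p2 : x ^ (3 * n + 1 + 1) = x ^ 2 := by rw [pow_succ, p1, sq]
      have r0 : x ^ (2 * (3 * n) + 2) = x ^ 2 := by
        rw [show 2 * (3 * n) + 2 = 3 * (2 * n) + 2 by ring, pow_add, pow_mul, hx3, one_pow, one_mul]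
      have r1 : x ^ (2 * (3 * n + 1) + 2) = x := by
        rw [show 2 * (3 * n + 1) + 2 = 3 * (2 * n + 1) + 1 by ring, pow_add, pow_mul, hx3, one_pow,
          one_mul, pow_one]
      have r2 : x ^ (2 * (3 * n + 1 + 1) + 2) = 1 := by
        rw [show 2 * (3 * n + 1 + 1) + 2 = 3 * (2 * n + 2) by ring, pow_mul, hx3, one_pow]
      have hx2 : x ^ 2 = -x - 1 := by linear_combination hx
      rw [p0, p1, p2, r0, r1, r2, hx2]
      simp only [invDiff]
      ring

/-- A logarithmic-derivative form of the cubic theta quotient `b(q)² / b(q²)`. -/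
lemma one_add_six_mul_Sser {q : ℂ} (hq0 : q ≠ 0) (hq : ‖q‖ < 1) :
    1 + 6 * Sser (-q) (q ^ 3) =
      poch (-q ^ 3) (q ^ 3) / poch (-q) q ^ 3 / (poch (q ^ 3) (q ^ 3) / poch q q ^ 3) := by
  obtain ⟨x, hxp⟩ : ∃ x : ℂ, IsPrimitiveRoot x 3 := ⟨_, Complex.isPrimitiveRoot_exp 3 three_ne_zero⟩
  have hx3 : x ^ 3 = 1 := hxp.pow_eq_one
  have hx1 : ‖x‖ = 1 := hxp.norm'_eq_one three_ne_zero
  have hx_ne : x - 1 ≠ 0 := sub_ne_zero.mpr (hxp.ne_one (by norm_num))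
  have hx : x ^ 2 + x + 1 = 0 := by
    refine (mul_eq_zero.mp ?_).resolve_left hx_ne
    linear_combination hx3
  have hx0 : x ≠ 0 := by rintro rfl; norm_num at hx3
  have hnq : ‖-q‖ < 1 := by simpa using hq
  have hW := poch_ne_zero_of_norm_lt hnq hq
  have hT : poch (-1) q = 2 * poch (-q) q := by
    rw [poch_eq_one_sub_mul (-1) hq]
    norm_num
  have hV : poch (-x) q = (1 + x) * poch (-(x * q)) q := by
    rw [poch_eq_one_sub_mul (-x) hq, sub_neg_eq_add, neg_mul]
  have hT0 : poch (-1) q ≠ 0 := by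
    rw [hT]
    exact mul_ne_zero two_ne_zero hW
  have tn : Tendsto (fun j : ℕ => 3 * j + 2) atTop atTop :=
    (tendsto_add_atTop_nat 2).comp (tendsto_id.const_mul_atTop' (three_pos : 0 < 3))
  have tU := (tendsto_finPoch (-(x ^ 2 * q)) hq).div (tendsto_finPoch (-q) hq) hW
  have tV := (tendsto_finPoch (-x) hq).div (tendsto_finPoch (-1) hq) hT0
  have tL := ((tU.comp (tendsto_add_atTop_nat 1)).mul (tV.comp (tendsto_add_atTop_nat 1))).sub
    ((tU.const_mul (x ^ 2)).mul (tV.comp (tendsto_add_atTop_nat 2)))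
  have tR := (tendsto_sum_pochRatio hx1 hq).const_mul (1 - x)
  have key := tendsto_nhds_unique (tL.comp tn) ((tR.comp tn).congr fun j =>
    (prod_ratio_sub hx3 hq0 hq
      (by rw [show 3 * j + 2 + 1 = 3 * (j + 1) by ring, pow_mul, hx3, one_pow])).symm)
  simp only [← add_mul, ← mul_assoc (invDiff q _)] at key
  rw [tsum_mul_right, tsum_invDiff_mul hx hx1 hq, hT, hV] at key
  have c1 := poch_cube hx q hq
  have c2 := poch_cube hx (-q) hq
  simp only [mul_neg, Odd.neg_pow (by decide : Odd 3)] at c2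
  have hP := poch_ne_zero_of_norm_lt hq hq
  have hq3 := norm_pow_lt_one hq three_ne_zero
  have hP3 := poch_ne_zero_of_norm_lt hq3 hq3
  rw [← c1] at hP3 ⊢
  rw [← c2]
  have hb := right_ne_zero_of_mul hP3
  have ha := right_ne_zero_of_mul (left_ne_zero_of_mul hP3)
  generalize Sser (-q) (q ^ 3) = S at *
  generalize poch (x * q) q = a at *
  generalize poch (x ^ 2 * q) q = b at *
  generalize poch (-(x * q)) q = c at *
  generalize poch (-(x ^ 2 * q)) q = d at *
  generalize poch (-q) q = w at *
  generalize poch q q = p at *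
  have key2 : d * c / w ^ 2 = (1 + 6 * S) * (a * b / p ^ 2) := by
    refine mul_left_cancel₀ (mul_ne_zero hx_ne hx0) ?_
    have e1 : d / w * ((1 + x) * c / (2 * w)) - x ^ 2 * (d / w) * ((1 + x) * c / (2 * w)) =
      (1 - x ^ 2) * (1 + x) / 2 * (d * c / w ^ 2) := by field_simp
    rw [e1] at key
    linear_combination (-2) * key + (d * c / w ^ 2) * (1 - x) * hx
  have : 1 + 6 * S = d * c / w ^ 2 / (a * b / p ^ 2) := by
    rw [key2]
    field_simp
  rw [this]
  field_simp

theorem stmt10 (q : ℂ) (hq0 : 0 < ‖q‖) (hq : ‖q‖ < 1) :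
    1 + 6 * Sser (-q) (q ^ 3)
      = (Jam 1 6 q) ^ 6 * (Jm 2 q) ^ 3 * (Jam 3 6 q) ^ 2 / (Jm 6 q) ^ 9 := by
  have hq_ne : q ≠ 0 := norm_pos_iff.mp hq0
  have n2 := norm_pow_lt_one hq two_ne_zero
  have n3 := norm_pow_lt_one hq three_ne_zero
  have n6 := norm_pow_lt_one hq (show 6 ≠ 0 by norm_num)
  have d1 := poch_mul_poch_neg q hq
  have d2 := poch_mul_poch_neg (q ^ 3) n3
  have d3 := poch_dissect_two q hq
  have d4 := poch_dissect_two (q ^ 3) n3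
  have d5 := poch_dissect_three q n2
  simp only [← pow_mul, ← pow_succ', ← sq] at d1 d2 d3 d4 d5
  norm_num at d1 d2 d3 d4 d5
  rw [one_add_six_mul_Sser hq_ne hq]
  simp only [Jam, Jm]
  norm_num
  have h1 := poch_ne_zero_of_norm_lt hq hq
  have h2 := poch_ne_zero_of_norm_lt n2 n2
  have h3 := poch_ne_zero_of_norm_lt n3 n3
  have h6 := poch_ne_zero_of_norm_lt n6 n6
  have e1 : poch (-q) q = poch (q ^ 2) (q ^ 2) / poch q q := by
    rw [← d1, mul_div_cancel_left₀ _ h1]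
  have e2 : poch (-q ^ 3) (q ^ 3) = poch (q ^ 6) (q ^ 6) / poch (q ^ 3) (q ^ 3) := by
    rw [← d2, mul_div_cancel_left₀ _ h3]
  rw [d5] at d3
  rw [e1, e2]
  rw [d3] at h1 ⊢
  rw [d4] at h3 ⊢
  have h8 := left_ne_zero_of_mul h3
  have h9 := left_ne_zero_of_mul h1
  have h10 := right_ne_zero_of_mul h9
  have h11 := left_ne_zero_of_mul (left_ne_zero_of_mul h9)
  field_simp
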